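/- Given a finite Kripke structure M and a PLTL formula ψ, if the incremental PLTL eventuality encoding ⟦M,¬ψ,k⟧ is satisfiable for some k, then there exists k̃ ≤ k such that ⟦M,¬ψ,k̃⟧ ∧ ⟦SimplePath⟧_{k̃} is satisfiable. -/

import Mathlib

namespace BMC

/-- PLTL formulas in positive normal form: literals `p`, `¬p`, conjunction,
disjunction, next `X`, until `U`, release `R`, previous `Y`, weak previous `Z`,
since `S` and trigger `T`. -/
inductive PLTL (AP : Type) : Type
  | atom  : AP → PLTL AP
  | natom : AP → PLTL AP
  | conj  : PLTL AP → PLTL AP → PLTL AP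
  | disj  : PLTL AP → PLTL AP → PLTL AP
  | next  : PLTL AP → PLTL AP
  | untl  : PLTL AP → PLTL AP → PLTL AP
  | rels  : PLTL AP → PLTL AP → PLTL AP
  | prev  : PLTL AP → PLTL AP
  | wprev : PLTL AP → PLTL AP
  | since : PLTL AP → PLTL AP → PLTL AP
  | trig  : PLTL AP → PLTL AP → PLTL AP

variable {AP S : Type}

/-- Standard PLTL semantics `π^i ⊨ φ` on an infinite sequence of states `π`
with labelling `L`. -/
def PLTL.sat (L : S → Set AP) (π : ℕ → S) : PLTL AP → ℕ → Prop
  | .atom p, i => p ∈ L (π i)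
  | .natom p, i => p ∉ L (π i)
  | .conj f g, i => PLTL.sat L π f i ∧ PLTL.sat L π g i
  | .disj f g, i => PLTL.sat L π f i ∨ PLTL.sat L π g i
  | .next f, i => PLTL.sat L π f (i + 1)
  | .untl f g, i => ∃ j, i ≤ j ∧ PLTL.sat L π g j ∧ ∀ n, i ≤ n → n < j → PLTL.sat L π f n
  | .rels f g, i => ∀ j, i ≤ j → (PLTL.sat L π g j ∨ ∃ n, i ≤ n ∧ n < j ∧ PLTL.sat L π f n)
  | .prev f, i => 0 < i ∧ PLTL.sat L π f (i - 1)
  | .wprev f, i => i = 0 ∨ PLTL.sat L π f (i - 1)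
  | .since f g, i => ∃ j, j ≤ i ∧ PLTL.sat L π g j ∧ ∀ n, j < n → n ≤ i → PLTL.sat L π f n
  | .trig f g, i => ∀ j, j ≤ i → (PLTL.sat L π g j ∨ ∃ n, j < n ∧ n ≤ i ∧ PLTL.sat L π f n)

/-- The no-loop bounded semantics `π^i ⊨_nl φ` with bound `k`: future operators
are restricted to positions `≤ k`. -/
def PLTL.satNL (L : S → Set AP) (π : ℕ → S) (k : ℕ) : PLTL AP → ℕ → Prop
  | .atom p, i => p ∈ L (π i)
  | .natom p, i => p ∉ L (π i)
  | .conj f g, i => PLTL.satNL L π k f i ∧ PLTL.satNL L π k g i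
  | .disj f g, i => PLTL.satNL L π k f i ∨ PLTL.satNL L π k g i
  | .next f, i => i < k ∧ PLTL.satNL L π k f (i + 1)
  | .untl f g, i => ∃ j, i ≤ j ∧ j ≤ k ∧ PLTL.satNL L π k g j ∧
      ∀ n, i ≤ n → n < j → PLTL.satNL L π k f n
  | .rels f g, i => ∃ j, i ≤ j ∧ j ≤ k ∧ PLTL.satNL L π k f j ∧
      ∀ n, i ≤ n → n ≤ j → PLTL.satNL L π k g n
  | .prev f, i => 0 < i ∧ PLTL.satNL L π k f (i - 1)
  | .wprev f, i => i = 0 ∨ PLTL.satNL L π k f (i - 1)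
  | .since f g, i => ∃ j, j ≤ i ∧ PLTL.satNL L π k g j ∧
      ∀ n, j < n → n ≤ i → PLTL.satNL L π k f n
  | .trig f g, i => ∀ j, j ≤ i → (PLTL.satNL L π k g j ∨
      ∃ n, j < n ∧ n ≤ i ∧ PLTL.satNL L π k f n)

/-- `π` is a (k,l)-loop: `0 < l ≤ k`, `π (l-1) = π k`, and from position `l`
onwards `π` is periodic with period `p = k + 1 - l`. -/
def IsKLoop (π : ℕ → S) (k l : ℕ) : Prop :=
  0 < l ∧ l ≤ k ∧ π (l - 1) = π k ∧ ∀ i, l ≤ i → π (i + (k + 1 - l)) = π i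

/-- The bounded semantics `π ⊨_k φ`. -/
def PLTL.bsat (L : S → Set AP) (π : ℕ → S) (k : ℕ) (φ : PLTL AP) : Prop :=
  (∃ l, IsKLoop π k l ∧ PLTL.sat L π φ 0) ∨ PLTL.satNL L π k φ 0

/-- The past operator depth `δ`. -/
def PLTL.delta : PLTL AP → ℕ
  | .atom _ => 0
  | .natom _ => 0
  | .conj f g => max f.delta g.delta
  | .disj f g => max f.delta g.delta
  | .next f => f.delta
  | .untl f g => max f.delta g.delta
  | .rels f g => max f.delta g.delta
  | .prev f => f.delta + 1
  | .wprev f => f.delta + 1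
  | .since f g => max f.delta g.delta + 1
  | .trig f g => max f.delta g.delta + 1

/-- A Kripke structure over state space `S` and atomic propositions `AP`. -/
structure Kripke (S AP : Type) where
  T : S → S → Prop
  I : S → Prop
  L : S → Set AP

/-- The transition relation is total. -/
def Kripke.Total (M : Kripke S AP) : Prop := ∀ s, ∃ s', M.T s s'

/-- An initialised infinite path of `M`. -/
def Kripke.InitPath (M : Kripke S AP) (π : ℕ → S) : Prop :=
  M.I (π 0) ∧ ∀ i, M.T (π i) (π (i + 1))

end BMC
namespace BMC

variable {AP S : Type}

/-- Model constraints `⟦M⟧_k = I(s_0) ∧ ⋀_{i=1}^k T(s_{i-1}, s_i)`. -/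
def ModelC (M : Kripke S AP) (k : ℕ) (s : ℕ → S) : Prop :=
  M.I (s 0) ∧ ∀ i, 1 ≤ i → i ≤ k → M.T (s (i - 1)) (s i)

/-- Loop constraints `⟦LoopConstraints⟧_k`. -/
def LoopC (k : ℕ) (s : ℕ → S) (lsel inL : ℕ → Prop) (LE : Prop) : Prop :=
  ¬ lsel 0 ∧ ¬ inL 0 ∧
  (∀ i, 1 ≤ i → i ≤ k → (lsel i → s (i - 1) = s k)) ∧
  (∀ i, 1 ≤ i → i ≤ k → (inL i ↔ (inL (i - 1) ∨ lsel i))) ∧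
  (∀ i, 1 ≤ i → i ≤ k → (inL (i - 1) → ¬ lsel i)) ∧
  (LE ↔ inL k)

end BMC
namespace BMC

variable {AP S : Type}

/-- Lookup of the virtually unrolled formula variable `⟦φ⟧^d_i`, using the
convention `⟦φ⟧^d_i = ⟦φ⟧^{δ(φ)}_i` when `d > δ(φ)`. -/
def pV (v : PLTL AP → ℕ → ℕ → Prop) (φ : PLTL AP) (d i : ℕ) : Prop :=
  v φ (min d φ.delta) i

/-- `⟦LastStateFormula⟧_k` constraints for one subformula `φ` of the PLTL
eventuality encoding. -/
def pLastC (k : ℕ) (lsel : ℕ → Prop) (LE : Prop)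
    (v : PLTL AP → ℕ → ℕ → Prop) (φ : PLTL AP) : Prop :=
  ∀ d, d ≤ φ.delta →
    (¬ LE → ¬ v φ d (k + 1)) ∧
    (∀ i, 1 ≤ i → i ≤ k → lsel i → (v φ d (k + 1) ↔ pV v φ (d + 1) i))

/-- The constraints `⟦EventualityPLTL⟧_k` (together with the
`⟦LastStateFormula⟧_k` constraints) of the PLTL eventuality encoding,
generated for a formula and, recursively, all of its subformulas.
`v φ d i` is the formula variable `⟦φ⟧^d_i` and `aux φ i` the auxiliary
variable `⟨⟨Fψ2⟩⟩^{δ(ψ2)}_i` (for until subformulas `φ = ψ1 U ψ2`)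
resp. `⟨⟨Gψ2⟩⟩^{δ(ψ2)}_i` (for release subformulas). -/
def pevC (k : ℕ) (L : S → Set AP) (s : ℕ → S) (lsel inL : ℕ → Prop)
    (LE : Prop) (v : PLTL AP → ℕ → ℕ → Prop) (aux : PLTL AP → ℕ → Prop) :
    PLTL AP → Prop
  | .atom p =>
      (∀ i, i ≤ k → (v (.atom p) 0 i ↔ p ∈ L (s i))) ∧
      pLastC k lsel LE v (.atom p)
  | .natom p =>
      (∀ i, i ≤ k → (v (.natom p) 0 i ↔ p ∉ L (s i))) ∧
      pLastC k lsel LE v (.natom p)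
  | .conj f g =>
      pevC k L s lsel inL LE v aux f ∧ pevC k L s lsel inL LE v aux g ∧
      (∀ d, d ≤ (PLTL.conj f g).delta → ∀ i, i ≤ k →
        (v (.conj f g) d i ↔ (pV v f d i ∧ pV v g d i))) ∧
      pLastC k lsel LE v (.conj f g)
  | .disj f g =>
      pevC k L s lsel inL LE v aux f ∧ pevC k L s lsel inL LE v aux g ∧
      (∀ d, d ≤ (PLTL.disj f g).delta → ∀ i, i ≤ k →
        (v (.disj f g) d i ↔ (pV v f d i ∨ pV v g d i))) ∧
      pLastC k lsel LE v (.disj f g)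
  | .next f =>
      pevC k L s lsel inL LE v aux f ∧
      (∀ d, d ≤ (PLTL.next f).delta → ∀ i, i ≤ k →
        (v (.next f) d i ↔ pV v f d (i + 1))) ∧
      pLastC k lsel LE v (.next f)
  | .untl f g =>
      pevC k L s lsel inL LE v aux f ∧ pevC k L s lsel inL LE v aux g ∧
      (∀ d, d ≤ (PLTL.untl f g).delta → ∀ i, i ≤ k →
        (v (.untl f g) d i ↔
          (pV v g d i ∨ (pV v f d i ∧ v (.untl f g) d (i + 1))))) ∧
      pLastC k lsel LE v (.untl f g) ∧
      (¬ aux (.untl f g) 0) ∧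
      (∀ i, 1 ≤ i → i ≤ k →
        (aux (.untl f g) i ↔
          (aux (.untl f g) (i - 1) ∨ (inL i ∧ v g g.delta i)))) ∧
      (LE → v (.untl f g) (PLTL.untl f g).delta k → aux (.untl f g) k)
  | .rels f g =>
      pevC k L s lsel inL LE v aux f ∧ pevC k L s lsel inL LE v aux g ∧
      (∀ d, d ≤ (PLTL.rels f g).delta → ∀ i, i ≤ k →
        (v (.rels f g) d i ↔
          (pV v g d i ∧ (pV v f d i ∨ v (.rels f g) d (i + 1))))) ∧
      pLastC k lsel LE v (.rels f g) ∧
      (aux (.rels f g) 0) ∧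
      (∀ i, 1 ≤ i → i ≤ k →
        (aux (.rels f g) i ↔
          (aux (.rels f g) (i - 1) ∧ (¬ inL i ∨ v g g.delta i)))) ∧
      (LE → aux (.rels f g) k → v (.rels f g) (PLTL.rels f g).delta k)
  | .prev f =>
      pevC k L s lsel inL LE v aux f ∧
      (∀ d, d ≤ (PLTL.prev f).delta → ¬ v (.prev f) d 0) ∧
      (∀ i, 1 ≤ i → i ≤ k → (v (.prev f) 0 i ↔ pV v f 0 (i - 1))) ∧
      (∀ d, 1 ≤ d → d ≤ (PLTL.prev f).delta → ∀ i, 1 ≤ i → i ≤ k →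
        (v (.prev f) d i ↔
          ((lsel i ∧ pV v f (d - 1) k) ∨ (¬ lsel i ∧ pV v f d (i - 1))))) ∧
      pLastC k lsel LE v (.prev f)
  | .wprev f =>
      pevC k L s lsel inL LE v aux f ∧
      (∀ d, d ≤ (PLTL.wprev f).delta → v (.wprev f) d 0) ∧
      (∀ i, 1 ≤ i → i ≤ k → (v (.wprev f) 0 i ↔ pV v f 0 (i - 1))) ∧
      (∀ d, 1 ≤ d → d ≤ (PLTL.wprev f).delta → ∀ i, 1 ≤ i → i ≤ k →
        (v (.wprev f) d i ↔
          ((lsel i ∧ pV v f (d - 1) k) ∨ (¬ lsel i ∧ pV v f d (i - 1))))) ∧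
      pLastC k lsel LE v (.wprev f)
  | .since f g =>
      pevC k L s lsel inL LE v aux f ∧ pevC k L s lsel inL LE v aux g ∧
      (∀ d, d ≤ (PLTL.since f g).delta → (v (.since f g) d 0 ↔ pV v g d 0)) ∧
      (∀ i, 1 ≤ i → i ≤ k →
        (v (.since f g) 0 i ↔
          (pV v g 0 i ∨ (pV v f 0 i ∧ v (.since f g) 0 (i - 1))))) ∧
      (∀ d, 1 ≤ d → d ≤ (PLTL.since f g).delta → ∀ i, 1 ≤ i → i ≤ k →
        (v (.since f g) d i ↔
          (pV v g d i ∨ (pV v f d i ∧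
            ((lsel i ∧ v (.since f g) (d - 1) k) ∨
             (¬ lsel i ∧ v (.since f g) d (i - 1))))))) ∧
      pLastC k lsel LE v (.since f g)
  | .trig f g =>
      pevC k L s lsel inL LE v aux f ∧ pevC k L s lsel inL LE v aux g ∧
      (∀ d, d ≤ (PLTL.trig f g).delta → (v (.trig f g) d 0 ↔ pV v g d 0)) ∧
      (∀ i, 1 ≤ i → i ≤ k →
        (v (.trig f g) 0 i ↔
          (pV v g 0 i ∧ (pV v f 0 i ∨ v (.trig f g) 0 (i - 1))))) ∧
      (∀ d, 1 ≤ d → d ≤ (PLTL.trig f g).delta → ∀ i, 1 ≤ i → i ≤ k →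
        (v (.trig f g) d i ↔
          (pV v g d i ∧ (pV v f d i ∨
            ((lsel i ∧ v (.trig f g) (d - 1) k) ∨
             (¬ lsel i ∧ v (.trig f g) d (i - 1))))))) ∧
      pLastC k lsel LE v (.trig f g)

/-- Satisfiability of the PLTL eventuality encoding
`⟦M,ψ,k⟧ = ⟦M⟧_k ∧ ⟦LoopConstraints⟧_k ∧ ⟦LastStateFormula⟧_k ∧
⟦EventualityPLTL⟧_k ∧ ⟦ψ⟧^0_0`. -/
def PEvSat (M : Kripke S AP) (ψ : PLTL AP) (k : ℕ) : Prop :=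
  ∃ (s : ℕ → S) (lsel inL : ℕ → Prop) (LE : Prop)
    (v : PLTL AP → ℕ → ℕ → Prop) (aux : PLTL AP → ℕ → Prop),
    ModelC M k s ∧ LoopC k s lsel inL LE ∧
    pevC k M.L s lsel inL LE v aux ψ ∧ v ψ 0 0

end BMC
namespace BMC

variable {AP S : Type}

/-- Lookup of a proxy formula variable (at index `E` or `L`) with the
convention that unrollings beyond `δ(φ)` are identified with `δ(φ)`. -/
def pW (w : PLTL AP → ℕ → Prop) (φ : PLTL AP) (d : ℕ) : Prop :=
  w φ (min d φ.delta)

/-- Loop constraints of the incremental PLTL eventuality encoding, using the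
proxy state `sE`; the flag `dep` controls whether the `k`-dependent
constraints (`s_E = s_k` and `LoopExists ⇔ InLoop_k`) are included. -/
def incLoopC (dep : Bool) (k : ℕ) (s : ℕ → S) (sE : S)
    (lsel inL : ℕ → Prop) (LE : Prop) : Prop :=
  ¬ lsel 0 ∧ ¬ inL 0 ∧
  (∀ i, 1 ≤ i → i ≤ k → (lsel i → s (i - 1) = sE)) ∧
  (∀ i, 1 ≤ i → i ≤ k → (inL i ↔ (inL (i - 1) ∨ lsel i))) ∧
  (∀ i, 1 ≤ i → i ≤ k → (inL (i - 1) → ¬ lsel i)) ∧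
  (dep = true → (LE ↔ inL k)) ∧
  (dep = true → sE = s k)

/-- The `⟦LastStateFormula⟧_k` constraints of the incremental encoding for one
subformula `φ`, with proxy variables `⟦φ⟧^d_L` and `⟦φ⟧^d_E`; the flag `dep`
controls the `k`-dependent constraints `⟦φ⟧^d_E ⇔ ⟦φ⟧^d_k` and
`⟦φ⟧^d_{k+1} ⇔ ⟦φ⟧^{min(d+1,δ(φ))}_L`. -/
def incLastC (dep : Bool) (k : ℕ) (lsel : ℕ → Prop) (LE : Prop)
    (v : PLTL AP → ℕ → ℕ → Prop) (vE vL : PLTL AP → ℕ → Prop)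
    (φ : PLTL AP) : Prop :=
  ∀ d, d ≤ φ.delta →
    (¬ LE → ¬ vL φ d) ∧
    (∀ i, 1 ≤ i → i ≤ k → lsel i → (vL φ d ↔ v φ d i)) ∧
    (dep = true → (vE φ d ↔ v φ d k)) ∧
    (dep = true → (v φ d (k + 1) ↔ pW vL φ (d + 1)))

/-- The constraints `⟦IncPLTL⟧_k` (together with `⟦LastStateFormula⟧_k`) of
the incremental PLTL eventuality encoding, generated recursively for all
subformulas.  `v φ d i` are the formula variables, `vE`/`vL` the proxy
variables at the proxy indices `E` resp. `L`, `aux φ i` the auxiliary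
variables and `auxE φ` their proxies at index `E`; the flag `dep` controls
whether the `k`-dependent constraints are included. -/
def pincC (dep : Bool) (k : ℕ) (L : S → Set AP) (s : ℕ → S)
    (lsel inL : ℕ → Prop) (LE : Prop) (v : PLTL AP → ℕ → ℕ → Prop)
    (vE vL : PLTL AP → ℕ → Prop) (aux : PLTL AP → ℕ → Prop)
    (auxE : PLTL AP → Prop) : PLTL AP → Prop
  | .atom p =>
      (∀ i, i ≤ k → (v (.atom p) 0 i ↔ p ∈ L (s i))) ∧
      incLastC dep k lsel LE v vE vL (.atom p)
  | .natom p =>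
      (∀ i, i ≤ k → (v (.natom p) 0 i ↔ p ∉ L (s i))) ∧
      incLastC dep k lsel LE v vE vL (.natom p)
  | .conj f g =>
      pincC dep k L s lsel inL LE v vE vL aux auxE f ∧
      pincC dep k L s lsel inL LE v vE vL aux auxE g ∧
      (∀ d, d ≤ (PLTL.conj f g).delta → ∀ i, i ≤ k →
        (v (.conj f g) d i ↔ (pV v f d i ∧ pV v g d i))) ∧
      incLastC dep k lsel LE v vE vL (.conj f g)
  | .disj f g =>
      pincC dep k L s lsel inL LE v vE vL aux auxE f ∧
      pincC dep k L s lsel inL LE v vE vL aux auxE g ∧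
      (∀ d, d ≤ (PLTL.disj f g).delta → ∀ i, i ≤ k →
        (v (.disj f g) d i ↔ (pV v f d i ∨ pV v g d i))) ∧
      incLastC dep k lsel LE v vE vL (.disj f g)
  | .next f =>
      pincC dep k L s lsel inL LE v vE vL aux auxE f ∧
      (∀ d, d ≤ (PLTL.next f).delta → ∀ i, i ≤ k →
        (v (.next f) d i ↔ pV v f d (i + 1))) ∧
      incLastC dep k lsel LE v vE vL (.next f)
  | .untl f g =>
      pincC dep k L s lsel inL LE v vE vL aux auxE f ∧
      pincC dep k L s lsel inL LE v vE vL aux auxE g ∧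
      (∀ d, d ≤ (PLTL.untl f g).delta → ∀ i, i ≤ k →
        (v (.untl f g) d i ↔
          (pV v g d i ∨ (pV v f d i ∧ v (.untl f g) d (i + 1))))) ∧
      incLastC dep k lsel LE v vE vL (.untl f g) ∧
      (¬ aux (.untl f g) 0) ∧
      (∀ i, 1 ≤ i → i ≤ k →
        (aux (.untl f g) i ↔
          (aux (.untl f g) (i - 1) ∨ (inL i ∧ v g g.delta i)))) ∧
      (LE → vE (.untl f g) (PLTL.untl f g).delta → auxE (.untl f g)) ∧
      (dep = true → (auxE (.untl f g) ↔ aux (.untl f g) k))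
  | .rels f g =>
      pincC dep k L s lsel inL LE v vE vL aux auxE f ∧
      pincC dep k L s lsel inL LE v vE vL aux auxE g ∧
      (∀ d, d ≤ (PLTL.rels f g).delta → ∀ i, i ≤ k →
        (v (.rels f g) d i ↔
          (pV v g d i ∧ (pV v f d i ∨ v (.rels f g) d (i + 1))))) ∧
      incLastC dep k lsel LE v vE vL (.rels f g) ∧
      (aux (.rels f g) 0) ∧
      (∀ i, 1 ≤ i → i ≤ k →
        (aux (.rels f g) i ↔
          (aux (.rels f g) (i - 1) ∧ (¬ inL i ∨ v g g.delta i)))) ∧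
      (LE → auxE (.rels f g) → vE (.rels f g) (PLTL.rels f g).delta) ∧
      (dep = true → (auxE (.rels f g) ↔ aux (.rels f g) k))
  | .prev f =>
      pincC dep k L s lsel inL LE v vE vL aux auxE f ∧
      (∀ d, d ≤ (PLTL.prev f).delta → ¬ v (.prev f) d 0) ∧
      (∀ i, 1 ≤ i → i ≤ k → (v (.prev f) 0 i ↔ pV v f 0 (i - 1))) ∧
      (∀ d, 1 ≤ d → d ≤ (PLTL.prev f).delta → ∀ i, 1 ≤ i → i ≤ k →
        (v (.prev f) d i ↔
          ((lsel i ∧ pW vE f (d - 1)) ∨ (¬ lsel i ∧ pV v f d (i - 1))))) ∧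
      incLastC dep k lsel LE v vE vL (.prev f)
  | .wprev f =>
      pincC dep k L s lsel inL LE v vE vL aux auxE f ∧
      (∀ d, d ≤ (PLTL.wprev f).delta → v (.wprev f) d 0) ∧
      (∀ i, 1 ≤ i → i ≤ k → (v (.wprev f) 0 i ↔ pV v f 0 (i - 1))) ∧
      (∀ d, 1 ≤ d → d ≤ (PLTL.wprev f).delta → ∀ i, 1 ≤ i → i ≤ k →
        (v (.wprev f) d i ↔
          ((lsel i ∧ pW vE f (d - 1)) ∨ (¬ lsel i ∧ pV v f d (i - 1))))) ∧
      incLastC dep k lsel LE v vE vL (.wprev f)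
  | .since f g =>
      pincC dep k L s lsel inL LE v vE vL aux auxE f ∧
      pincC dep k L s lsel inL LE v vE vL aux auxE g ∧
      (∀ d, d ≤ (PLTL.since f g).delta → (v (.since f g) d 0 ↔ pV v g d 0)) ∧
      (∀ i, 1 ≤ i → i ≤ k →
        (v (.since f g) 0 i ↔
          (pV v g 0 i ∨ (pV v f 0 i ∧ v (.since f g) 0 (i - 1))))) ∧
      (∀ d, 1 ≤ d → d ≤ (PLTL.since f g).delta → ∀ i, 1 ≤ i → i ≤ k →
        (v (.since f g) d i ↔
          (pV v g d i ∨ (pV v f d i ∧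
            ((lsel i ∧ vE (.since f g) (d - 1)) ∨
             (¬ lsel i ∧ v (.since f g) d (i - 1))))))) ∧
      incLastC dep k lsel LE v vE vL (.since f g)
  | .trig f g =>
      pincC dep k L s lsel inL LE v vE vL aux auxE f ∧
      pincC dep k L s lsel inL LE v vE vL aux auxE g ∧
      (∀ d, d ≤ (PLTL.trig f g).delta → (v (.trig f g) d 0 ↔ pV v g d 0)) ∧
      (∀ i, 1 ≤ i → i ≤ k →
        (v (.trig f g) 0 i ↔
          (pV v g 0 i ∧ (pV v f 0 i ∨ v (.trig f g) 0 (i - 1))))) ∧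
      (∀ d, 1 ≤ d → d ≤ (PLTL.trig f g).delta → ∀ i, 1 ≤ i → i ≤ k →
        (v (.trig f g) d i ↔
          (pV v g d i ∧ (pV v f d i ∨
            ((lsel i ∧ vE (.trig f g) (d - 1)) ∨
             (¬ lsel i ∧ v (.trig f g) d (i - 1))))))) ∧
      incLastC dep k lsel LE v vE vL (.trig f g)

/-- Satisfiability of the incremental PLTL eventuality encoding
`⟦M,ψ,k⟧ = ⟦M⟧_k ∧ ⟦LoopConstraints⟧_k ∧ ⟦LastStateFormula⟧_k ∧
⟦IncPLTL⟧_k ∧ ⟦ψ⟧^0_0` (the witness formula). -/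
def IncSat (M : Kripke S AP) (ψ : PLTL AP) (k : ℕ) : Prop :=
  ∃ (s : ℕ → S) (sE : S) (lsel inL : ℕ → Prop) (LE : Prop)
    (v : PLTL AP → ℕ → ℕ → Prop) (vE vL : PLTL AP → ℕ → Prop)
    (aux : PLTL AP → ℕ → Prop) (auxE : PLTL AP → Prop),
    ModelC M k s ∧ incLoopC true k s sE lsel inL LE ∧
    pincC true k M.L s lsel inL LE v vE vL aux auxE ψ ∧ v ψ 0 0

end BMC
namespace BMC

variable {AP S : Type}

/-- Negation of a PNF formula, via the standard dualities. -/
def PLTL.neg : PLTL AP → PLTL AP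
  | .atom p => .natom p
  | .natom p => .atom p
  | .conj f g => .disj f.neg g.neg
  | .disj f g => .conj f.neg g.neg
  | .next f => .next f.neg
  | .untl f g => .rels f.neg g.neg
  | .rels f g => .untl f.neg g.neg
  | .prev f => .wprev f.neg
  | .wprev f => .prev f.neg
  | .since f g => .trig f.neg g.neg
  | .trig f g => .since f.neg g.neg

/-- The list of subformulas of a PLTL formula. -/
def PLTL.subfs : PLTL AP → List (PLTL AP)
  | .atom p => [.atom p]
  | .natom p => [.natom p]
  | .conj f g => .conj f g :: (f.subfs ++ g.subfs)
  | .disj f g => .disj f g :: (f.subfs ++ g.subfs)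
  | .next f => .next f :: f.subfs
  | .untl f g => .untl f g :: (f.subfs ++ g.subfs)
  | .rels f g => .rels f g :: (f.subfs ++ g.subfs)
  | .prev f => .prev f :: f.subfs
  | .wprev f => .wprev f :: f.subfs
  | .since f g => .since f g :: (f.subfs ++ g.subfs)
  | .trig f g => .trig f g :: (f.subfs ++ g.subfs)

/-- `φ` is an until or release formula (so that it carries auxiliary
variables in the encoding). -/
def PLTL.isUR : PLTL AP → Prop
  | .untl _ _ => True
  | .rels _ _ => True
  | _ => False

/-- The simple path formula `⟦SimplePath⟧_k` for the incremental encoding of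
the formula `χ`: any two distinct positions `i < j ≤ k` differ in the system
state, in `InLoop`, in the formula variables at unrolling `0`, or (when both
are in the loop) in the full vectors of formula variables or of auxiliary
variables. -/
def SimplePathC (χ : PLTL AP) (k : ℕ) (s : ℕ → S) (inL : ℕ → Prop)
    (v : PLTL AP → ℕ → ℕ → Prop) (aux : PLTL AP → ℕ → Prop) : Prop :=
  ∀ i j, i < j → j ≤ k →
    (s i ≠ s j ∨
     ¬ (inL i ↔ inL j) ∨
     (∃ φ ∈ χ.subfs, ¬ (v φ 0 i ↔ v φ 0 j)) ∨
     (inL i ∧ inL j ∧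
       ((∃ φ ∈ χ.subfs, ∃ d, d ≤ PLTL.delta φ ∧ ¬ (v φ d i ↔ v φ d j)) ∨
        (∃ φ ∈ χ.subfs, φ.isUR ∧ ¬ (aux φ i ↔ aux φ j)))))

/-- Satisfiability of the witness formula `⟦M,χ,k⟧` conjoined with the simple
path formula `⟦SimplePath⟧_k`. -/
def WitSPSat (M : Kripke S AP) (χ : PLTL AP) (k : ℕ) : Prop :=
  ∃ (s : ℕ → S) (sE : S) (lsel inL : ℕ → Prop) (LE : Prop)
    (v : PLTL AP → ℕ → ℕ → Prop) (vE vL : PLTL AP → ℕ → Prop)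
    (aux : PLTL AP → ℕ → Prop) (auxE : PLTL AP → Prop),
    ModelC M k s ∧ incLoopC true k s sE lsel inL LE ∧
    pincC true k M.L s lsel inL LE v vE vL aux auxE χ ∧ v χ 0 0 ∧
    SimplePathC χ k s inL v aux

/-- Satisfiability of the completeness formula `⟦⟦M,χ,k⟧⟧` (the witness
formula with all `k`-dependent constraints removed) conjoined with the simple
path formula `⟦SimplePath⟧_k`. -/
def ComplSPSat (M : Kripke S AP) (χ : PLTL AP) (k : ℕ) : Prop :=
  ∃ (s : ℕ → S) (sE : S) (lsel inL : ℕ → Prop) (LE : Prop)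
    (v : PLTL AP → ℕ → ℕ → Prop) (vE vL : PLTL AP → ℕ → Prop)
    (aux : PLTL AP → ℕ → Prop) (auxE : PLTL AP → Prop),
    ModelC M k s ∧ incLoopC false k s sE lsel inL LE ∧
    pincC false k M.L s lsel inL LE v vE vL aux auxE χ ∧ v χ 0 0 ∧
    SimplePathC χ k s inL v aux

/-- `M ⊨ ψ`: every initialised infinite path of `M` satisfies `ψ`. -/
def Kripke.Models (M : Kripke S AP) (ψ : PLTL AP) : Prop :=
  ∀ π : ℕ → S, M.InitPath π → PLTL.sat M.L π ψ 0

end BMC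
namespace BMC

variable {AP S : Type}

open Classical in
def bwd (K : ℕ) (G b : ℕ → Prop) (F : ℕ → Prop → Prop) (m : ℕ) : Prop :=
  if G m ∨ K < m then b m else F m (bwd K G b F (m + 1))
termination_by K + 1 - m
decreasing_by omega

open Classical in
def fwd (G b : ℕ → Prop) (Z : Prop) (F : ℕ → Prop → Prop) : ℕ → Prop
  | 0 => if G 0 then b 0 else Z
  | m + 1 => if G (m + 1) then b (m + 1) else F (m + 1) (fwd G b Z F m)

open Classical in
def rW (v0 : PLTL AP → ℕ → ℕ → Prop) (G : ℕ → ℕ → Prop) (K : ℕ) : PLTL AP → ℕ → ℕ → Prop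
  | .atom p => v0 (.atom p)
  | .natom p => v0 (.natom p)
  | .conj f g => fun d m => if G d m then v0 (.conj f g) d m else
      (rW v0 G K f (min d f.delta) m ∧ rW v0 G K g (min d g.delta) m)
  | .disj f g => fun d m => if G d m then v0 (.disj f g) d m else
      (rW v0 G K f (min d f.delta) m ∨ rW v0 G K g (min d g.delta) m)
  | .next f => fun d m => if G d m then v0 (.next f) d m else
      rW v0 G K f (min d f.delta) (m + 1)
  | .untl f g => fun d => bwd K (G d) (v0 (.untl f g) d) (fun m u =>
      (rW v0 G K g (min d g.delta) m ∨ (rW v0 G K f (min d f.delta) m ∧ u)))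
  | .rels f g => fun d => bwd K (G d) (v0 (.rels f g) d) (fun m u =>
      (rW v0 G K g (min d g.delta) m ∧ (rW v0 G K f (min d f.delta) m ∨ u)))
  | .prev f => fun d m => if G d m then v0 (.prev f) d m else
      (1 ≤ m ∧ rW v0 G K f (min d f.delta) (m - 1))
  | .wprev f => fun d m => if G d m then v0 (.wprev f) d m else
      (m = 0 ∨ rW v0 G K f (min d f.delta) (m - 1))
  | .since f g => fun d => fwd (G d) (v0 (.since f g) d) (rW v0 G K g (min d g.delta) 0)
      (fun m u => (rW v0 G K g (min d g.delta) m ∨ (rW v0 G K f (min d f.delta) m ∧ u)))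
  | .trig f g => fun d => fwd (G d) (v0 (.trig f g) d) (rW v0 G K g (min d g.delta) 0)
      (fun m u => (rW v0 G K g (min d g.delta) m ∧ (rW v0 G K f (min d f.delta) m ∨ u)))

theorem bwd_G {K : ℕ} {G b : ℕ → Prop} {F : ℕ → Prop → Prop} {m : ℕ} (h : G m) :
    bwd K G b F m ↔ b m := by
  rw [bwd]; simp [h]

theorem bwd_N {K : ℕ} {G b : ℕ → Prop} {F : ℕ → Prop → Prop} {m : ℕ} (h : ¬ G m) (hm : m ≤ K) :
    bwd K G b F m ↔ F m (bwd K G b F (m + 1)) := by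
  rw [bwd]; simp [h, Nat.not_lt.2 hm]

theorem fwd_G {G b : ℕ → Prop} {Z : Prop} {F : ℕ → Prop → Prop} {m : ℕ} (h : G m) :
    fwd G b Z F m ↔ b m := by
  cases m <;> simp [fwd, h]

theorem fwd_N {G b : ℕ → Prop} {Z : Prop} {F : ℕ → Prop → Prop} {m : ℕ} (h : ¬ G m)
    (hm : 1 ≤ m) :
    fwd G b Z F m ↔ F m (fwd G b Z F (m - 1)) := by
  cases m with
  | zero => omega
  | succ m => simp [fwd, h]

theorem rW_G (v0 : PLTL AP → ℕ → ℕ → Prop) (G : ℕ → ℕ → Prop) (K : ℕ) (φ : PLTL AP)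
    {d m : ℕ} (h : G d m) : rW v0 G K φ d m ↔ v0 φ d m := by
  cases φ <;> simp only [rW, h, if_true]
  · exact bwd_G h
  · exact bwd_G h
  · exact fwd_G h
  · exact fwd_G h

theorem self_subfs (φ : PLTL AP) : φ ∈ φ.subfs := by
  cases φ <;> simp [PLTL.subfs]

/-- The data of a cut of a path. -/
structure Cut (k K : ℕ) (s : ℕ → S) (lsel inL : ℕ → Prop) (LE : Prop) (σ τ : ℕ → ℕ) : Prop where
  s0 : σ 0 = 0
  ts : ∀ m, τ m + 1 = σ (m + 1)
  tK : τ K = k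
  sle : ∀ m, m ≤ K → σ m ≤ k
  tle : ∀ m, m ≤ K → τ m ≤ k
  spos : ∀ m, 1 ≤ m → 1 ≤ σ m
  st : ∀ m, m ≤ K → s (τ m) = s (σ m)
  it : ∀ m, m ≤ K → (inL (τ m) ↔ inL (σ m))
  nl0 : ¬ inL 0
  irec : ∀ i, 1 ≤ i → i ≤ k → (inL i ↔ (inL (i - 1) ∨ lsel i))
  le : LE ↔ inL k

section
variable {k K : ℕ} {s : ℕ → S} {lsel inL : ℕ → Prop} {LE : Prop} {σ τ : ℕ → ℕ}

theorem Cut.pred (c : Cut k K s lsel inL LE σ τ) {m : ℕ} (hm : 1 ≤ m) : σ m - 1 = τ (m - 1) := by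
  have := c.ts (m - 1)
  rw [Nat.sub_add_cancel hm] at this
  omega

theorem Cut.mono (c : Cut k K s lsel inL LE σ τ) {i j : ℕ} (hij : i ≤ j) (hj : j ≤ k)
    (hi : inL i) : inL j := by
  induction j, hij using Nat.le_induction with
  | base => exact hi
  | succ j h ih => exact (c.irec (j + 1) (by omega) hj).2 (Or.inl (by simpa using ih (by omega)))

def cG (K : ℕ) (inL : ℕ → Prop) (σ : ℕ → ℕ) (d m : ℕ) : Prop :=
  d = 0 ∨ inL (σ m) ∨ K < m

theorem Cut.G_succ (c : Cut k K s lsel inL LE σ τ) {d m : ℕ} (hm : m ≤ K)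
    (h : cG K inL σ d m) : cG K inL σ d (m + 1) := by
  rcases h with h | h | h
  · exact Or.inl h
  · by_cases hK : K < m + 1
    · exact Or.inr (Or.inr hK)
    · refine Or.inr (Or.inl ?_)
      rw [← c.ts]
      have := c.sle (m + 1) (by omega)
      rw [← c.ts] at this
      exact c.mono (Nat.le_succ _) this ((c.it m hm).2 h)
  · exact Or.inr (Or.inr (by omega))

theorem Cut.G_pred (c : Cut k K s lsel inL LE σ τ) {d m : ℕ} (h1 : 1 ≤ m) (hm : m ≤ K)
    (hl : d = 0 ∨ ¬ lsel (σ m)) (h : cG K inL σ d m) : cG K inL σ d (m - 1) := by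
  rcases h with h | h | h
  · exact Or.inl h
  · rcases hl with hl | hl
    · exact Or.inl hl
    refine Or.inr (Or.inl ?_)
    have := (c.irec _ (c.spos m h1) (c.sle m hm)).1 h
    rw [c.pred h1, c.it _ (by omega)] at this
    tauto
  · omega

theorem Cut.sel_in (c : Cut k K s lsel inL LE σ τ) {m : ℕ} (h1 : 1 ≤ m) (hm : m ≤ K)
    (hl : lsel (σ m)) : inL (σ m) :=
  (c.irec _ (c.spos m h1) (c.sle m hm)).2 (Or.inr hl)

theorem cG_min {d m e : ℕ} (h : cG K inL σ d m) : cG K inL σ (min d e) m := by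
  rcases h with h | h
  · left; simp [h]
  · exact Or.inr h

theorem Cut.GK (c : Cut k K s lsel inL LE σ τ) {d : ℕ} (h : LE) : cG K inL σ d K := by
  right; left
  rw [← c.it K le_rfl, c.tK]; exact c.le.1 h

theorem Cut.LE_of (c : Cut k K s lsel inL LE σ τ) {m : ℕ} (h1 : 1 ≤ m) (hm : m ≤ K)
    (hl : lsel (σ m)) : LE :=
  c.le.2 (c.mono (c.sle m hm) le_rfl (c.sel_in h1 hm hl))

/-- equality of the formula variables at the cut -/
def EqAt (K : ℕ) (inL : ℕ → Prop) (σ τ : ℕ → ℕ) (v : PLTL AP → ℕ → ℕ → Prop)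
    (φ : PLTL AP) : Prop :=
  ∀ d m, d ≤ φ.delta → m ≤ K → cG K inL σ d m → (v φ d (τ m) ↔ v φ d (σ m))

def AuxAt (K : ℕ) (inL : ℕ → Prop) (σ τ : ℕ → ℕ) (aux : PLTL AP → ℕ → Prop)
    (φ : PLTL AP) : Prop :=
  ∀ m, m ≤ K → inL (σ m) → (aux φ (τ m) ↔ aux φ (σ m))

abbrev nW (K : ℕ) (inL : ℕ → Prop) (σ : ℕ → ℕ) (v : PLTL AP → ℕ → ℕ → Prop) :
    PLTL AP → ℕ → ℕ → Prop :=
  rW (fun φ d m => v φ d (σ m)) (cG K inL σ) K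

theorem nW_G {v : PLTL AP → ℕ → ℕ → Prop} (φ : PLTL AP) {d m : ℕ} (h : cG K inL σ d m) :
    nW K inL σ v φ d m ↔ v φ d (σ m) := rW_G _ _ _ _ h

theorem pnW_G {v : PLTL AP → ℕ → ℕ → Prop} (φ : PLTL AP) {d m : ℕ} (h : cG K inL σ d m) :
    pV (nW K inL σ v) φ d m ↔ pV v φ d (σ m) := rW_G _ _ _ _ (cG_min h)

theorem EqAt.p {v : PLTL AP → ℕ → ℕ → Prop} {φ : PLTL AP} (e : EqAt K inL σ τ v φ) {d m : ℕ}
    (hm : m ≤ K) (h : cG K inL σ d m) : pV v φ d (τ m) ↔ pV v φ d (σ m) :=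
  e _ _ (min_le_right _ _) hm (cG_min h)

theorem Cut.last (c : Cut k K s lsel inL LE σ τ) {v : PLTL AP → ℕ → ℕ → Prop}
    {vE vL : PLTL AP → ℕ → Prop} {φ : PLTL AP}
    (h : incLastC true k lsel LE v vE vL φ) :
    incLastC true K (fun m => lsel (σ m)) LE (nW K inL σ v)
      (fun φ d => nW K inL σ v φ d K) vL φ := by
  intro d hd
  obtain ⟨h1, h2, h3, h4⟩ := h d hd
  refine ⟨h1, ?_, fun _ => Iff.rfl, fun _ => ?_⟩
  · intro i hi hiK hl
    rw [h2 _ (c.spos i hi) (c.sle i hiK) hl, nW_G _ (Or.inr (Or.inl (c.sel_in hi hiK hl)))]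
  · rw [nW_G _ (Or.inr (Or.inr (Nat.lt_succ_self K))), ← c.ts, c.tK]
    exact h4 rfl

theorem Cut.vE_eq (c : Cut k K s lsel inL LE σ τ) {v : PLTL AP → ℕ → ℕ → Prop}
    {vE vL : PLTL AP → ℕ → Prop} {φ : PLTL AP} (e : EqAt K inL σ τ v φ)
    (h : incLastC true k lsel LE v vE vL φ) (hl : LE) {d : ℕ} (hd : d ≤ φ.delta) :
    vE φ d ↔ nW K inL σ v φ d K := by
  rw [nW_G _ (c.GK hl), ← e d K hd le_rfl (c.GK hl), c.tK]
  exact (h d hd).2.2.1 rfl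

theorem pinc_last {dep : Bool} {L : S → Set AP} {v : PLTL AP → ℕ → ℕ → Prop}
    {vE vL : PLTL AP → ℕ → Prop}
    {aux : PLTL AP → ℕ → Prop} {auxE : PLTL AP → Prop} {φ : PLTL AP}
    (h : pincC dep k L s lsel inL LE v vE vL aux auxE φ) :
    incLastC dep k lsel LE v vE vL φ := by
  cases φ <;> simp only [pincC] at h <;>
    first
    | exact h.2
    | exact h.2.2
    | exact h.2.2.2
    | exact h.2.2.2.1
    | exact h.2.2.2.2
    | exact h.2.2.2.2.2

theorem notG {d m : ℕ} (h : ¬ cG K inL σ d m) : 1 ≤ d ∧ ¬ inL (σ m) ∧ m ≤ K := by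
  unfold cG at h; push Not at h; exact ⟨by omega, h.2⟩

end

section
variable {k K : ℕ} {s : ℕ → S} {lsel inL : ℕ → Prop} {LE : Prop} {σ τ : ℕ → ℕ}

theorem Cut.not_sel (c : Cut k K s lsel inL LE σ τ) {d m : ℕ} (h1 : 1 ≤ m) (hm : m ≤ K)
    (h : ¬ cG K inL σ d m) : ¬ lsel (σ m) :=
  fun hl => (notG h).2.1 (c.sel_in h1 hm hl)

set_option maxHeartbeats 4000000 in
theorem pinc_cut (c : Cut k K s lsel inL LE σ τ) {L : S → Set AP}
    {v : PLTL AP → ℕ → ℕ → Prop} {vE vL : PLTL AP → ℕ → Prop}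
    {aux : PLTL AP → ℕ → Prop} {auxE : PLTL AP → Prop} (φ : PLTL AP)
    (e : ∀ χ ∈ φ.subfs, EqAt K inL σ τ v χ)
    (ea : ∀ χ ∈ φ.subfs, χ.isUR → AuxAt K inL σ τ aux χ)
    (h : pincC true k L s lsel inL LE v vE vL aux auxE φ) :
    pincC true K L (fun m => s (σ m)) (fun m => lsel (σ m)) (fun m => inL (σ m)) LE
      (nW K inL σ v) (fun φ d => nW K inL σ v φ d K) vL (fun χ m => aux χ (σ m)) auxE φ := by
  have eself := e φ (self_subfs φ)
  have hlast := pinc_last h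
  have hlast' := c.last hlast
  induction φ with
  | atom p =>
    refine ⟨fun i hi => ?_, hlast'⟩
    rw [nW_G _ (Or.inl rfl)]
    exact h.1 _ (c.sle i hi)
  | natom p =>
    refine ⟨fun i hi => ?_, hlast'⟩
    rw [nW_G _ (Or.inl rfl)]
    exact h.1 _ (c.sle i hi)
  | conj f g ihf ihg =>
    have ef : ∀ χ ∈ f.subfs, χ ∈ (PLTL.conj f g).subfs := by simp +contextual [PLTL.subfs]
    have eg : ∀ χ ∈ g.subfs, χ ∈ (PLTL.conj f g).subfs := by simp +contextual [PLTL.subfs]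
    obtain ⟨hf, hg, h1, -⟩ := h
    refine ⟨ihf (fun χ hχ => e χ (ef χ hχ)) (fun χ hχ => ea χ (ef χ hχ)) hf
        (e _ (ef _ (self_subfs f))) (pinc_last hf) (c.last (pinc_last hf)),
      ihg (fun χ hχ => e χ (eg χ hχ)) (fun χ hχ => ea χ (eg χ hχ)) hg
        (e _ (eg _ (self_subfs g))) (pinc_last hg) (c.last (pinc_last hg)), ?_, hlast'⟩
    intro d hd m hm
    by_cases hG : cG K inL σ d m
    · rw [nW_G _ hG, pnW_G _ hG, pnW_G _ hG]
      exact h1 d hd _ (c.sle m hm)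
    · simp only [nW, rW, hG, if_false, pV]
  | disj f g ihf ihg =>
    have ef : ∀ χ ∈ f.subfs, χ ∈ (PLTL.disj f g).subfs := by simp +contextual [PLTL.subfs]
    have eg : ∀ χ ∈ g.subfs, χ ∈ (PLTL.disj f g).subfs := by simp +contextual [PLTL.subfs]
    obtain ⟨hf, hg, h1, -⟩ := h
    refine ⟨ihf (fun χ hχ => e χ (ef χ hχ)) (fun χ hχ => ea χ (ef χ hχ)) hf
        (e _ (ef _ (self_subfs f))) (pinc_last hf) (c.last (pinc_last hf)),
      ihg (fun χ hχ => e χ (eg χ hχ)) (fun χ hχ => ea χ (eg χ hχ)) hg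
        (e _ (eg _ (self_subfs g))) (pinc_last hg) (c.last (pinc_last hg)), ?_, hlast'⟩
    intro d hd m hm
    by_cases hG : cG K inL σ d m
    · rw [nW_G _ hG, pnW_G _ hG, pnW_G _ hG]
      exact h1 d hd _ (c.sle m hm)
    · simp only [nW, rW, hG, if_false, pV]
  | next f ihf =>
    have ef : ∀ χ ∈ f.subfs, χ ∈ (PLTL.next f).subfs := by simp +contextual [PLTL.subfs]
    obtain ⟨hf, h1, -⟩ := h
    refine ⟨ihf (fun χ hχ => e χ (ef χ hχ)) (fun χ hχ => ea χ (ef χ hχ)) hf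
        (e _ (ef _ (self_subfs f))) (pinc_last hf) (c.last (pinc_last hf)), ?_, hlast'⟩
    intro d hd m hm
    by_cases hG : cG K inL σ d m
    · rw [nW_G _ hG, pnW_G _ (c.G_succ hm hG), ← eself d m hd hm hG, ← c.ts]
      exact h1 d hd _ (c.tle m hm)
    · simp only [nW, rW, hG, if_false, pV]
  | untl f g ihf ihg =>
    have ef : ∀ χ ∈ f.subfs, χ ∈ (PLTL.untl f g).subfs := by simp +contextual [PLTL.subfs]
    have eg : ∀ χ ∈ g.subfs, χ ∈ (PLTL.untl f g).subfs := by simp +contextual [PLTL.subfs]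
    obtain ⟨hf, hg, h1, -, h2, h3, h4, h5⟩ := h
    have eF := e _ (ef _ (self_subfs f))
    have eG := e _ (eg _ (self_subfs g))
    have hout : ∀ m, m ≤ k → ¬ inL m → ¬ aux (.untl f g) m := by
      intro m
      induction m with
      | zero => exact fun _ _ => h2
      | succ m ih =>
        intro hm hn
        have hr := c.irec (m + 1) (by omega) hm
        rw [h3 (m + 1) (by omega) hm]
        simp only [Nat.add_sub_cancel] at hr ⊢
        have := ih (by omega)
        tauto
    have ha : ∀ m, m ≤ K → (aux (.untl f g) (τ m) ↔ aux (.untl f g) (σ m)) := by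
      intro m hm
      by_cases hi : inL (σ m)
      · exact ea _ (self_subfs _) trivial m hm hi
      · exact iff_of_false (hout _ (c.tle m hm) (by rwa [c.it m hm])) (hout _ (c.sle m hm) hi)
    refine ⟨ihf (fun χ hχ => e χ (ef χ hχ)) (fun χ hχ => ea χ (ef χ hχ)) hf
        (e _ (ef _ (self_subfs f))) (pinc_last hf) (c.last (pinc_last hf)),
      ihg (fun χ hχ => e χ (eg χ hχ)) (fun χ hχ => ea χ (eg χ hχ)) hg
        (e _ (eg _ (self_subfs g))) (pinc_last hg) (c.last (pinc_last hg)), ?_, hlast',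
      by simpa [c.s0] using h2, ?_, ?_, ?_⟩
    · intro d hd m hm
      by_cases hG : cG K inL σ d m
      · rw [nW_G _ hG, pnW_G _ hG, pnW_G _ hG, nW_G _ (c.G_succ hm hG), ← eself d m hd hm hG,
          ← c.ts, ← eF.p hm hG, ← eG.p hm hG]
        exact h1 d hd _ (c.tle m hm)
      · exact bwd_N hG hm
    · intro m h1m hm
      have := h3 _ (c.spos m h1m) (c.sle m hm)
      rw [c.pred h1m, ha _ (by omega)] at this
      simp only
      rw [this]
      refine or_congr Iff.rfl (and_congr_right fun hi => ?_)
      exact (nW_G _ (Or.inr (Or.inl hi))).symm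
    · intro hl hw
      exact h4 hl ((c.vE_eq eself hlast hl le_rfl).2 hw)
    · intro _
      beta_reduce
      rw [← ha K le_rfl, c.tK]; exact h5 rfl
  | rels f g ihf ihg =>
    have ef : ∀ χ ∈ f.subfs, χ ∈ (PLTL.rels f g).subfs := by simp +contextual [PLTL.subfs]
    have eg : ∀ χ ∈ g.subfs, χ ∈ (PLTL.rels f g).subfs := by simp +contextual [PLTL.subfs]
    obtain ⟨hf, hg, h1, -, h2, h3, h4, h5⟩ := h
    have eF := e _ (ef _ (self_subfs f))
    have eG := e _ (eg _ (self_subfs g))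
    have hout : ∀ m, m ≤ k → ¬ inL m → aux (.rels f g) m := by
      intro m
      induction m with
      | zero => exact fun _ _ => h2
      | succ m ih =>
        intro hm hn
        have hr := c.irec (m + 1) (by omega) hm
        rw [h3 (m + 1) (by omega) hm]
        simp only [Nat.add_sub_cancel] at hr ⊢
        have := ih (by omega)
        tauto
    have ha : ∀ m, m ≤ K → (aux (.rels f g) (τ m) ↔ aux (.rels f g) (σ m)) := by
      intro m hm
      by_cases hi : inL (σ m)
      · exact ea _ (self_subfs _) trivial m hm hi
      · exact iff_of_true (hout _ (c.tle m hm) (by rwa [c.it m hm])) (hout _ (c.sle m hm) hi)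
    refine ⟨ihf (fun χ hχ => e χ (ef χ hχ)) (fun χ hχ => ea χ (ef χ hχ)) hf
        (e _ (ef _ (self_subfs f))) (pinc_last hf) (c.last (pinc_last hf)),
      ihg (fun χ hχ => e χ (eg χ hχ)) (fun χ hχ => ea χ (eg χ hχ)) hg
        (e _ (eg _ (self_subfs g))) (pinc_last hg) (c.last (pinc_last hg)), ?_, hlast',
      by simpa [c.s0] using h2, ?_, ?_, ?_⟩
    · intro d hd m hm
      by_cases hG : cG K inL σ d m
      · rw [nW_G _ hG, pnW_G _ hG, pnW_G _ hG, nW_G _ (c.G_succ hm hG), ← eself d m hd hm hG,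
          ← c.ts, ← eF.p hm hG, ← eG.p hm hG]
        exact h1 d hd _ (c.tle m hm)
      · exact bwd_N hG hm
    · intro m h1m hm
      have := h3 _ (c.spos m h1m) (c.sle m hm)
      rw [c.pred h1m, ha _ (by omega)] at this
      simp only
      rw [this]
      refine and_congr Iff.rfl ?_
      by_cases hi : inL (σ m)
      · rw [nW_G _ (Or.inr (Or.inl hi))]
      · simp [hi]
    · intro hl hw
      exact (c.vE_eq eself hlast hl le_rfl).1 (h4 hl hw)
    · intro _
      beta_reduce
      rw [← ha K le_rfl, c.tK]; exact h5 rfl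
  | prev f ihf =>
    have ef : ∀ χ ∈ f.subfs, χ ∈ (PLTL.prev f).subfs := by simp +contextual [PLTL.subfs]
    obtain ⟨hf, h1, h2, h3, -⟩ := h
    have eF := e _ (ef _ (self_subfs f))
    refine ⟨ihf (fun χ hχ => e χ (ef χ hχ)) (fun χ hχ => ea χ (ef χ hχ)) hf
        (e _ (ef _ (self_subfs f))) (pinc_last hf) (c.last (pinc_last hf)), ?_, ?_, ?_, hlast'⟩
    · intro d hd
      by_cases hG : cG K inL σ d 0
      · rw [nW_G _ hG, c.s0]; exact h1 d hd
      · simp [nW, rW, hG]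
    · intro m h1m hm
      rw [nW_G _ (Or.inl rfl), pnW_G _ (Or.inl rfl), ← eF.p (by omega) (Or.inl rfl), ← c.pred h1m]
      exact h2 _ (c.spos m h1m) (c.sle m hm)
    · intro d h1d hd m h1m hm
      by_cases hG : cG K inL σ d m
      · rw [nW_G _ hG, h3 d h1d hd _ (c.spos m h1m) (c.sle m hm)]
        refine or_congr (and_congr_right fun hl => ?_) (and_congr_right fun hl => ?_)
        · exact c.vE_eq eF (pinc_last hf) (c.LE_of h1m hm hl) (min_le_right _ _)
        · have hG' := c.G_pred h1m hm (Or.inr hl) hG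
          rw [pnW_G _ hG', c.pred h1m, eF.p (by omega) hG']
      · have := c.not_sel h1m hm hG
        simp [nW, rW, hG, this, pV, h1m]
  | wprev f ihf =>
    have ef : ∀ χ ∈ f.subfs, χ ∈ (PLTL.wprev f).subfs := by simp +contextual [PLTL.subfs]
    obtain ⟨hf, h1, h2, h3, -⟩ := h
    have eF := e _ (ef _ (self_subfs f))
    refine ⟨ihf (fun χ hχ => e χ (ef χ hχ)) (fun χ hχ => ea χ (ef χ hχ)) hf
        (e _ (ef _ (self_subfs f))) (pinc_last hf) (c.last (pinc_last hf)), ?_, ?_, ?_, hlast'⟩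
    · intro d hd
      by_cases hG : cG K inL σ d 0
      · rw [nW_G _ hG, c.s0]; exact h1 d hd
      · simp [nW, rW, hG]
    · intro m h1m hm
      rw [nW_G _ (Or.inl rfl), pnW_G _ (Or.inl rfl), ← eF.p (by omega) (Or.inl rfl), ← c.pred h1m]
      exact h2 _ (c.spos m h1m) (c.sle m hm)
    · intro d h1d hd m h1m hm
      by_cases hG : cG K inL σ d m
      · rw [nW_G _ hG, h3 d h1d hd _ (c.spos m h1m) (c.sle m hm)]
        refine or_congr (and_congr_right fun hl => ?_) (and_congr_right fun hl => ?_)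
        · exact c.vE_eq eF (pinc_last hf) (c.LE_of h1m hm hl) (min_le_right _ _)
        · have hG' := c.G_pred h1m hm (Or.inr hl) hG
          rw [pnW_G _ hG', c.pred h1m, eF.p (by omega) hG']
      · have := c.not_sel h1m hm hG
        simp [nW, rW, hG, this, pV, Nat.one_le_iff_ne_zero.1 h1m]
  | since f g ihf ihg =>
    have ef : ∀ χ ∈ f.subfs, χ ∈ (PLTL.since f g).subfs := by simp +contextual [PLTL.subfs]
    have eg : ∀ χ ∈ g.subfs, χ ∈ (PLTL.since f g).subfs := by simp +contextual [PLTL.subfs]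
    obtain ⟨hf, hg, h1, h2, h3, -⟩ := h
    refine ⟨ihf (fun χ hχ => e χ (ef χ hχ)) (fun χ hχ => ea χ (ef χ hχ)) hf
        (e _ (ef _ (self_subfs f))) (pinc_last hf) (c.last (pinc_last hf)),
      ihg (fun χ hχ => e χ (eg χ hχ)) (fun χ hχ => ea χ (eg χ hχ)) hg
        (e _ (eg _ (self_subfs g))) (pinc_last hg) (c.last (pinc_last hg)), ?_, ?_, ?_, hlast'⟩
    · intro d hd
      by_cases hG : cG K inL σ d 0
      · rw [nW_G _ hG, pnW_G _ hG, c.s0]; exact h1 d hd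
      · simp [nW, rW, hG, fwd, pV]
    · intro m h1m hm
      rw [nW_G _ (Or.inl rfl), pnW_G _ (Or.inl rfl), pnW_G _ (Or.inl rfl), nW_G _ (Or.inl rfl),
        ← eself 0 (m - 1) (Nat.zero_le _) (by omega) (Or.inl rfl), ← c.pred h1m]
      exact h2 _ (c.spos m h1m) (c.sle m hm)
    · intro d h1d hd m h1m hm
      by_cases hG : cG K inL σ d m
      · rw [nW_G _ hG, h3 d h1d hd _ (c.spos m h1m) (c.sle m hm), pnW_G _ hG, pnW_G _ hG]
        refine or_congr Iff.rfl (and_congr Iff.rfl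
          (or_congr (and_congr_right fun hl => ?_) (and_congr_right fun hl => ?_)))
        · exact c.vE_eq eself hlast (c.LE_of h1m hm hl) (by omega)
        · have hG' := c.G_pred h1m hm (Or.inr hl) hG
          rw [nW_G _ hG', c.pred h1m, eself _ _ hd (by omega) hG']
      · have := c.not_sel h1m hm hG
        simp only [this, false_and, not_false_eq_true, true_and, false_or]
        exact fwd_N hG h1m
  | trig f g ihf ihg =>
    have ef : ∀ χ ∈ f.subfs, χ ∈ (PLTL.trig f g).subfs := by simp +contextual [PLTL.subfs]
    have eg : ∀ χ ∈ g.subfs, χ ∈ (PLTL.trig f g).subfs := by simp +contextual [PLTL.subfs]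
    obtain ⟨hf, hg, h1, h2, h3, -⟩ := h
    refine ⟨ihf (fun χ hχ => e χ (ef χ hχ)) (fun χ hχ => ea χ (ef χ hχ)) hf
        (e _ (ef _ (self_subfs f))) (pinc_last hf) (c.last (pinc_last hf)),
      ihg (fun χ hχ => e χ (eg χ hχ)) (fun χ hχ => ea χ (eg χ hχ)) hg
        (e _ (eg _ (self_subfs g))) (pinc_last hg) (c.last (pinc_last hg)), ?_, ?_, ?_, hlast'⟩
    · intro d hd
      by_cases hG : cG K inL σ d 0
      · rw [nW_G _ hG, pnW_G _ hG, c.s0]; exact h1 d hd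
      · simp [nW, rW, hG, fwd, pV]
    · intro m h1m hm
      rw [nW_G _ (Or.inl rfl), pnW_G _ (Or.inl rfl), pnW_G _ (Or.inl rfl), nW_G _ (Or.inl rfl),
        ← eself 0 (m - 1) (Nat.zero_le _) (by omega) (Or.inl rfl), ← c.pred h1m]
      exact h2 _ (c.spos m h1m) (c.sle m hm)
    · intro d h1d hd m h1m hm
      by_cases hG : cG K inL σ d m
      · rw [nW_G _ hG, h3 d h1d hd _ (c.spos m h1m) (c.sle m hm), pnW_G _ hG, pnW_G _ hG]
        refine and_congr Iff.rfl (or_congr Iff.rfl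
          (or_congr (and_congr_right fun hl => ?_) (and_congr_right fun hl => ?_)))
        · exact c.vE_eq eself hlast (c.LE_of h1m hm hl) (by omega)
        · have hG' := c.G_pred h1m hm (Or.inr hl) hG
          rw [nW_G _ hG', c.pred h1m, eself _ _ hd (by omega) hG']
      · have := c.not_sel h1m hm hG
        simp only [this, false_and, not_false_eq_true, true_and, false_or]
        exact fwd_N hG h1m

end

theorem shrink_step (M : Kripke S AP) (χ : PLTL AP) (k : ℕ) (h : IncSat M χ k)
    (hn : ¬ WitSPSat M χ k) : ∃ K, K < k ∧ IncSat M χ K := by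
  obtain ⟨s, sE, lsel, inL, LE, v, vE, vL, aux, auxE, hM, hL, hP, h0⟩ := h
  have hns : ¬ SimplePathC χ k s inL v aux := fun hS =>
    hn ⟨s, sE, lsel, inL, LE, v, vE, vL, aux, auxE, hM, hL, hP, h0, hS⟩
  unfold SimplePathC at hns
  push Not at hns
  obtain ⟨i, j, hij, hjk, hs, hi, hv, hl⟩ := hns
  obtain ⟨l1, l2, l3, l4, l5, l6, l7⟩ := hL
  let σ : ℕ → ℕ := fun m => if m ≤ i then m else m + (j - i)
  let τ : ℕ → ℕ := fun m => if m < i then m else m + (j - i)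
  have key : ∀ m, (σ m = τ m) ∨ (σ m = i ∧ τ m = j) := by
    intro m
    simp only [σ, τ]
    split_ifs <;> omega
  have c : Cut k (k - (j - i)) s lsel inL LE σ τ := by
    refine ⟨by simp [σ], ?_, ?_, ?_, ?_, ?_, ?_, ?_, l2, l4, l6 rfl⟩
    · intro m; simp only [σ, τ]; split_ifs <;> omega
    · simp only [τ]; split_ifs <;> omega
    · intro m hm; simp only [σ]; split_ifs <;> omega
    · intro m hm; simp only [τ]; split_ifs <;> omega
    · intro m hm; simp only [σ]; split_ifs <;> omega
    · intro m hm
      rcases key m with h | ⟨h, h'⟩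
      · rw [h]
      · rw [h, h', hs]
    · intro m hm
      rcases key m with h | ⟨h, h'⟩
      · rw [h]
      · rw [h, h', hi]
  have e : ∀ φ ∈ χ.subfs, EqAt (k - (j - i)) inL σ τ v φ := by
    intro φ hφ d m hd hm hG
    rcases key m with h | ⟨h, h'⟩
    · rw [h]
    · rw [h, h']
      rcases hG with hG | hG | hG
      · rw [hG]; exact (hv φ hφ).symm
      · rw [h] at hG
        exact ((hl hG (hi.1 hG)).1 φ hφ d hd).symm
      · omega
  have ea : ∀ φ ∈ χ.subfs, φ.isUR → AuxAt (k - (j - i)) inL σ τ aux φ := by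
    intro φ hφ hu m hm hG
    rcases key m with h | ⟨h, h'⟩
    · rw [h]
    · rw [h, h']
      rw [h] at hG
      exact ((hl hG (hi.1 hG)).2 φ hφ hu).symm
  refine ⟨k - (j - i), by omega, _, sE, _, _, LE, _, _, vL, _, auxE, ?_, ?_,
    pinc_cut c χ e ea hP, ?_⟩
  · refine ⟨by simpa [c.s0] using hM.1, fun m h1 hm => ?_⟩
    have := hM.2 _ (c.spos m h1) (c.sle m hm)
    rwa [c.pred h1, c.st _ (by omega)] at this
  · refine ⟨by simpa [c.s0] using l1, by simpa [c.s0] using l2, ?_, ?_, ?_, ?_, ?_⟩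
    · intro m h1 hm hsel
      have := l3 _ (c.spos m h1) (c.sle m hm) hsel
      rwa [c.pred h1, c.st _ (by omega)] at this
    · intro m h1 hm
      have := l4 _ (c.spos m h1) (c.sle m hm)
      rwa [c.pred h1, c.it _ (by omega)] at this
    · intro m h1 hm
      have := l5 _ (c.spos m h1) (c.sle m hm)
      rwa [c.pred h1, c.it _ (by omega)] at this
    · intro _
      beta_reduce
      rw [← c.it _ le_rfl, c.tK]; exact l6 rfl
    · intro _
      beta_reduce
      rw [← c.st _ le_rfl, c.tK]; exact l7 rfl
  · rw [nW_G _ (Or.inl rfl), c.s0]; exact h0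

end BMC

open BMC in
/-- Lemma: if the incremental PLTL eventuality encoding `⟦M,¬ψ,k⟧` is
satisfiable for some `k`, then there is `k̃ ≤ k` such that
`⟦M,¬ψ,k̃⟧ ∧ ⟦SimplePath⟧_{k̃}` is satisfiable. -/
theorem witness_shrinks_to_simple_path {S AP : Type} [Finite S]
    (M : Kripke S AP) (hTot : M.Total) (ψ : PLTL AP) (k : ℕ)
    (h : IncSat M ψ.neg k) :
    ∃ kt, kt ≤ k ∧ WitSPSat M ψ.neg kt := by
  induction k using Nat.strong_induction_on with
  | _ k ih =>
    by_cases hn : WitSPSat M ψ.neg k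
    · exact ⟨k, le_rfl, hn⟩
    · obtain ⟨K, hK, hS⟩ := shrink_step M _ k h hn
      obtain ⟨kt, h1, h2⟩ := ih K hK hS
      exact ⟨kt, by omega, h2⟩
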